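/- Let x and y be two nonzero vectors in ℝ^m that are not scalar multiples of one another, let u = x/‖x‖₂, assume ‖x‖₂ > ‖y‖₂, let β > 1, and let α* = 1 − √(1 − (β‖x‖₂² − ‖y‖₂²)/(β(uᵀx)² − (uᵀy)²)) be the value from Lemma 1. Then ‖(I − α* u uᵀ) y‖₂² = β ‖(I − α* u uᵀ) x‖₂² > ‖(I − α* u uᵀ) x‖₂²; in particular x is not a maximizer of the function z ↦ ‖(I − α* u uᵀ) z‖₂² over any set of vectors containing both x and y. -/

import Mathlib

open RealInnerProductSpace

/-- Squared norm of `(I - α u uᵀ) z` for a unit vector `u`. -/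
theorem norm_sub_smul_inner_smul_sq {E : Type*} [NormedAddCommGroup E] [InnerProductSpace ℝ E]
    {u : E} (hu : ‖u‖ = 1) (z : E) (α : ℝ) :
    ‖z - α • ⟪u, z⟫ • u‖ ^ 2 = ‖z‖ ^ 2 - (1 - (1 - α) ^ 2) * ⟪u, z⟫ ^ 2 := by
  rw [smul_smul, norm_sub_sq_real, inner_smul_right, norm_smul, mul_pow, hu, Real.norm_eq_abs,
    sq_abs, real_inner_comm]
  ring

/-- Diversification property of Robust SPA: with `α*` as in Lemma 1, one has
`‖(I − α* u uᵀ) y‖₂² = β ‖(I − α* u uᵀ) x‖₂² > ‖(I − α* u uᵀ) x‖₂²`; in particular `x`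
does not maximize `z ↦ ‖(I − α* u uᵀ) z‖₂²` over any set containing both `x` and `y`. -/
theorem rspa_diversification {m : ℕ} (x y u : EuclideanSpace ℝ (Fin m))
    (hx : x ≠ 0) (hy : y ≠ 0)
    (hnm : ∀ t : ℝ, x ≠ t • y ∧ y ≠ t • x)
    (hu : u = ‖x‖⁻¹ • x)
    (hxy : ‖y‖ < ‖x‖)
    (β : ℝ) (hβ : 1 < β)
    (αstar : ℝ)
    (hαstar : αstar =
      1 - Real.sqrt (1 - (β * ‖x‖ ^ 2 - ‖y‖ ^ 2) / (β * ⟪u, x⟫ ^ 2 - ⟪u, y⟫ ^ 2))) :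
    ‖y - αstar • ⟪u, y⟫ • u‖ ^ 2 = β * ‖x - αstar • ⟪u, x⟫ • u‖ ^ 2 ∧
      β * ‖x - αstar • ⟪u, x⟫ • u‖ ^ 2 > ‖x - αstar • ⟪u, x⟫ • u‖ ^ 2 ∧
      ∀ S : Set (EuclideanSpace ℝ (Fin m)), x ∈ S → y ∈ S →
        ¬ (∀ z ∈ S, ‖z - αstar • ⟪u, z⟫ • u‖ ^ 2 ≤ ‖x - αstar • ⟪u, x⟫ • u‖ ^ 2) := by
  have hx_pos : 0 < ‖x‖ := norm_pos_iff.mpr hx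
  have hu_norm : ‖u‖ = 1 := by
    rw [hu, norm_smul, norm_inv, norm_norm, inv_mul_cancel₀ hx_pos.ne']
  have hux : ⟪u, x⟫ = ‖x‖ := by
    rw [hu, real_inner_smul_left, real_inner_self_eq_norm_sq]
    field_simp
  have hcs : ⟪u, y⟫ ^ 2 < ‖y‖ ^ 2 := by
    have hne : y - (1 : ℝ) • ⟪u, y⟫ • u ≠ 0 := by
      intro h
      refine (hnm (⟪u, y⟫ * ‖x‖⁻¹)).2 ?_
      rw [mul_smul, ← hu]
      simpa using sub_eq_zero.mp h
    have hpos := pow_pos (norm_pos_iff.mpr hne) 2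
    rw [norm_sub_smul_inner_smul_sq hu_norm] at hpos
    linarith
  have hyx : ‖y‖ ^ 2 < ‖x‖ ^ 2 := pow_lt_pow_left₀ hxy (norm_nonneg y) two_ne_zero
  have hden : 0 < β * ‖x‖ ^ 2 - ⟪u, y⟫ ^ 2 := by
    nlinarith [pow_pos hx_pos 2]
  have hratio : 1 - (β * ‖x‖ ^ 2 - ‖y‖ ^ 2) / (β * ‖x‖ ^ 2 - ⟪u, y⟫ ^ 2) =
      (‖y‖ ^ 2 - ⟪u, y⟫ ^ 2) / (β * ‖x‖ ^ 2 - ⟪u, y⟫ ^ 2) := by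
    rw [eq_div_iff hden.ne', sub_mul, div_mul_cancel₀ _ hden.ne']
    ring
  have hratio_pos := div_pos (sub_pos.mpr hcs) hden
  have hsq : (1 - αstar) ^ 2 = (‖y‖ ^ 2 - ⟪u, y⟫ ^ 2) / (β * ‖x‖ ^ 2 - ⟪u, y⟫ ^ 2) := by
    rw [hαstar, hux, hratio, sub_sub_cancel, Real.sq_sqrt hratio_pos.le]
  have hx_image : ‖x - αstar • ⟪u, x⟫ • u‖ ^ 2 = (1 - αstar) ^ 2 * ‖x‖ ^ 2 := by
    rw [norm_sub_smul_inner_smul_sq hu_norm, hux]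
    ring
  have heq : ‖y - αstar • ⟪u, y⟫ • u‖ ^ 2 = β * ‖x - αstar • ⟪u, x⟫ • u‖ ^ 2 := by
    rw [hx_image, norm_sub_smul_inner_smul_sq hu_norm]
    linarith [(eq_div_iff hden.ne').mp hsq]
  have hgt : β * ‖x - αstar • ⟪u, x⟫ • u‖ ^ 2 > ‖x - αstar • ⟪u, x⟫ • u‖ ^ 2 := by
    refine lt_mul_of_one_lt_left ?_ hβ
    rw [hx_image, hsq]
    positivity
  exact ⟨heq, hgt, fun S _ hyS hmax => absurd (hmax y hyS) (not_le.mpr (heq ▸ hgt))⟩
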